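/- Let α > 0 and let v be a radial function. If α ≠ 1, assume Σ_{k=−∞}^{m} max(p^k, p^{αk}) |v(p^k)| < ∞ and Σ_{ℓ=m}^{∞} |v(p^ℓ)| < ∞ for some m ∈ ℤ; if α = 1, assume Σ_{k=−∞}^{m} |k| p^k |v(p^k)| < ∞ and Σ_{ℓ=m}^{∞} ℓ |v(p^ℓ)| < ∞ for some m ∈ ℤ. Then for every x ≠ 0 the value (D^α (I^α v))(x) is defined (all defining integrals converge) and equals v(|x|_p); that is, I^α is a right inverse of D^α on such radial functions. -/

import Mathlib

open MeasureTheory Metric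

noncomputable section

variable (p : ℕ) [Fact p.Prime]

instance : MeasurableSpace ℚ_[p] := borel _
instance : BorelSpace ℚ_[p] := ⟨rfl⟩

/-- The closed unit ball of `ℚ_[p]` as a positive compact set. -/
def unitBallPC : TopologicalSpace.PositiveCompacts ℚ_[p] where
  carrier := closedBall 0 1
  isCompact' := isCompact_closedBall 0 1
  interior_nonempty' := ⟨0, mem_interior_iff_mem_nhds.2
    (Filter.mem_of_superset (ball_mem_nhds 0 one_pos) ball_subset_closedBall)⟩

/-- The Haar measure on `ℚ_[p]` normalized so the unit ball has measure 1. -/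
def padicHaar : Measure ℚ_[p] := Measure.addHaarMeasure (unitBallPC p)

/-- A point on the sphere of radius `p^k`. -/
def sph (k : ℤ) : ℚ_[p] := (p : ℚ_[p]) ^ (-k)

/-- A function is radial if it depends only on the p-adic absolute value. -/
def Radial (u : ℚ_[p] → ℝ) : Prop := ∀ x y : ℚ_[p], ‖x‖ = ‖y‖ → u x = u y

/-- The integrand of the Vladimirov operator `D^α` at `x`. -/
def Dker (α : ℝ) (u : ℚ_[p] → ℝ) (x : ℚ_[p]) : ℚ_[p] → ℝ :=
  fun y => ‖y‖ ^ (-α - 1) * (u (x - y) - u x)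

/-- The Vladimirov fractional differentiation operator. -/
def Dop (α : ℝ) (u : ℚ_[p] → ℝ) (x : ℚ_[p]) : ℝ :=
  ((1 - (p : ℝ) ^ α) / (1 - (p : ℝ) ^ (-α - 1))) * ∫ y, Dker p α u x y ∂(padicHaar p)

/-- The kernel of the fractional integral `I^α`. -/
def Iker (α : ℝ) (x y : ℚ_[p]) : ℝ :=
  if α = 1 then Real.log ‖x - y‖ - Real.log ‖y‖
  else ‖x - y‖ ^ (α - 1) - ‖y‖ ^ (α - 1)

/-- The constant in front of the fractional integral. -/
def Icoef (α : ℝ) : ℝ :=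
  if α = 1 then (1 - (p : ℝ)) / (p * Real.log p)
  else (1 - (p : ℝ) ^ (-α)) / (1 - (p : ℝ) ^ (α - 1))

/-- The p-adic fractional integral `I^α`. -/
def Iop (α : ℝ) (u : ℚ_[p] → ℝ) (x : ℚ_[p]) : ℝ :=
  Icoef p α * ∫ y in {y : ℚ_[p] | ‖y‖ ≤ ‖x‖}, Iker p α x y * u y ∂(padicHaar p)

end

open Filter Topology

section measurePart

variable (p : ℕ) [Fact p.Prime]

instance padicHaar_isHaar : (padicHaar p).IsAddHaarMeasure := by
  unfold padicHaar; infer_instance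

lemma q_gt_one : (1 : ℝ) < p := by exact_mod_cast (Fact.out : p.Prime).one_lt

lemma haar_null (x : ℚ_[p]) : padicHaar p {x} = 0 := by
  have : Filter.NeBot (𝓝[≠] (0 : ℚ_[p])) := inferInstance
  exact measure_singleton x

lemma norm_sph (k : ℤ) : ‖sph p k‖ = (p : ℝ) ^ k := by
  simp [sph]

lemma padic_exists_norm {x : ℚ_[p]} (hx : x ≠ 0) : ∃ n : ℤ, ‖x‖ = (p : ℝ) ^ n :=
  ⟨_, Padic.norm_eq_zpow_neg_valuation hx⟩

lemma closedBall_step (k : ℤ) :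
    closedBall (0 : ℚ_[p]) ((p : ℝ) ^ (k + 1)) =
      ⋃ i : Fin p, (fun y => (-((i : ℕ) : ℚ_[p]) * sph p (k + 1)) + y) ⁻¹'
        closedBall (0 : ℚ_[p]) ((p : ℝ) ^ k) := by
  have hq := q_gt_one p
  have hq0 : (0 : ℝ) < p := by linarith
  have hp0 : (p : ℚ_[p]) ≠ 0 := by exact_mod_cast (Fact.out : p.Prime).ne_zero
  ext y
  simp only [mem_closedBall, dist_zero_right, Set.mem_iUnion, Set.mem_preimage]
  constructor
  · intro hy
    have hz : ‖y * sph p (-(k + 1))‖ ≤ 1 := by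
      rw [norm_mul, norm_sph, zpow_neg]
      exact (mul_inv_le_iff₀ (by positivity)).2 (by simpa using hy)
    obtain ⟨n, hn, hn2⟩ := PadicInt.exists_mem_range (⟨_, hz⟩ : ℤ_[p])
    refine ⟨⟨n, hn⟩, ?_⟩
    have h3 : ‖(y * sph p (-(k + 1)) - (n : ℚ_[p]))‖ < 1 := by
      have := (IsLocalRing.mem_maximalIdeal _).1 hn2
      rw [PadicInt.mem_nonunits, PadicInt.norm_def] at this
      exact this
    have h4 : ‖(y * sph p (-(k + 1)) - (n : ℚ_[p]))‖ ≤ (p : ℝ) ^ (-1 : ℤ) := by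
      rw [Padic.norm_le_pow_iff_norm_lt_pow_add_one]; simpa using h3
    have h5 : -((n : ℕ) : ℚ_[p]) * sph p (k + 1) + y =
        (y * sph p (-(k + 1)) - (n : ℚ_[p])) * sph p (k + 1) := by
      have : sph p (-(k + 1)) * sph p (k + 1) = 1 := by
        unfold sph; rw [← zpow_add₀ hp0]; simp
      linear_combination (-y) * this
    simp only
    rw [h5, norm_mul, norm_sph]
    calc _ ≤ (p : ℝ) ^ (-1 : ℤ) * (p : ℝ) ^ (k + 1) := by gcongr
      _ = _ := by rw [← zpow_add₀ hq0.ne']; congr 1; ring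
  · rintro ⟨i, hi⟩
    have h1 : ‖((i : ℕ) : ℚ_[p]) * sph p (k + 1)‖ ≤ (p : ℝ) ^ (k + 1) := by
      rw [norm_mul, norm_sph]
      have : ‖((i : ℕ) : ℚ_[p])‖ ≤ 1 := by
        simpa using Padic.norm_int_le_one (p := p) (i : ℤ)
      exact mul_le_of_le_one_left (by positivity) this
    have h2 : (p : ℝ) ^ k ≤ (p : ℝ) ^ (k + 1) := zpow_le_zpow_right₀ hq.le (by lia)
    have : y = ((i : ℕ) : ℚ_[p]) * sph p (k + 1) + (-((i : ℕ) : ℚ_[p]) * sph p (k + 1) + y) := by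
      ring
    rw [this]
    exact (Padic.nonarchimedean _ _).trans (max_le h1 (hi.trans h2))

lemma haar_step (k : ℤ) :
    padicHaar p (closedBall (0 : ℚ_[p]) ((p : ℝ) ^ (k + 1))) =
      p * padicHaar p (closedBall (0 : ℚ_[p]) ((p : ℝ) ^ k)) := by
  have hq := q_gt_one p
  have hq0 : (0 : ℝ) < p := by linarith
  rw [closedBall_step, measure_iUnion]
  · simp only [measure_preimage_add]
    rw [tsum_fintype]; simp
  · intro i j hij
    refine Set.disjoint_left.2 fun y hi hj => hij ?_
    simp only [mem_closedBall, dist_zero_right, Set.mem_preimage] at hi hj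
    have h1 : ‖(((i : ℕ) : ℚ_[p]) - ((j : ℕ) : ℚ_[p])) * sph p (k + 1)‖ ≤ (p : ℝ) ^ k := by
      have : (((i : ℕ) : ℚ_[p]) - ((j : ℕ) : ℚ_[p])) * sph p (k + 1) =
        (-((j : ℕ) : ℚ_[p]) * sph p (k + 1) + y) + -(-((i : ℕ) : ℚ_[p]) * sph p (k + 1) + y) := by
        ring
      rw [this]
      exact (Padic.nonarchimedean _ _).trans (max_le hj (by rwa [norm_neg]))
    rw [norm_mul, norm_sph, zpow_add₀ hq0.ne', zpow_one] at h1
    have h3 : ‖((((i : ℕ) : ℤ) - ((j : ℕ) : ℤ) : ℤ) : ℚ_[p])‖ < 1 := by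
      push_cast
      by_contra hc
      push Not at hc
      have : (0 : ℝ) < p ^ k := by positivity
      nlinarith [mul_pos this (sub_pos.2 hq), mul_le_mul_of_nonneg_right hc (by positivity : (0 : ℝ) ≤ p ^ k * p)]
    rw [Padic.norm_intCast_lt_one_iff] at h3
    have := i.2
    have := j.2
    ext
    obtain ⟨c, hc⟩ := h3
    rcases lt_trichotomy c 0 with h | h | h
    · nlinarith
    · subst h; lia
    · nlinarith
  · intro i
    exact (measurable_const_add _) isClosed_closedBall.measurableSet

lemma haar_closedBall (k : ℤ) :
    (padicHaar p).real (closedBall (0 : ℚ_[p]) ((p : ℝ) ^ k)) = (p : ℝ) ^ k := by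
  have hq := q_gt_one p
  have hq0 : (0 : ℝ) < p := by linarith
  have hs : ∀ k : ℤ, (padicHaar p).real (closedBall (0 : ℚ_[p]) ((p : ℝ) ^ (k + 1))) =
      p * (padicHaar p).real (closedBall (0 : ℚ_[p]) ((p : ℝ) ^ k)) := by
    intro k; simp [Measure.real, haar_step]
  induction k using Int.induction_on with
  | zero =>
    have : padicHaar p (closedBall (0 : ℚ_[p]) 1) = 1 :=
      Measure.addHaarMeasure_self (K₀ := unitBallPC p)
    simp [Measure.real, this]
  | succ i ih => rw [hs, ih, zpow_add_one₀ hq0.ne']; ring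
  | pred i ih =>
    have := hs (-(i : ℤ) - 1)
    rw [sub_add_cancel, ih] at this
    have h2 : (p : ℝ) ^ (-(i : ℤ) - 1) = (p : ℝ) ^ (-(i : ℤ)) / p := by
      rw [zpow_sub_one₀ hq0.ne']; rfl
    exact (h2.trans ((div_eq_iff hq0.ne').2 (this.trans (mul_comm _ _)))).symm

lemma padic_ball_eq (k : ℤ) : ball (0 : ℚ_[p]) ((p : ℝ) ^ k) = closedBall 0 ((p : ℝ) ^ (k - 1)) := by
  ext y
  simp only [mem_ball, mem_closedBall, dist_zero_right]
  rw [Padic.norm_le_pow_iff_norm_lt_pow_add_one, sub_add_cancel]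

lemma haar_ball (x : ℚ_[p]) (k : ℤ) :
    (padicHaar p).real (ball x ((p : ℝ) ^ k)) = (p : ℝ) ^ (k - 1) := by
  rw [← haar_closedBall p (k - 1), ← padic_ball_eq]
  simp only [Measure.real]
  rw [Measure.addHaar_ball_center]

lemma haar_sphere (k : ℤ) :
    (padicHaar p).real (sphere (0 : ℚ_[p]) ((p : ℝ) ^ k)) = (1 - 1 / p) * (p : ℝ) ^ k := by
  have hq := q_gt_one p
  have hq0 : (0 : ℝ) < p := by linarith
  rw [← closedBall_sdiff_ball, measureReal_sdiff ball_subset_closedBall measurableSet_ball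
    (isCompact_closedBall _ _).measure_lt_top.ne, haar_closedBall, haar_ball,
    zpow_sub_one₀ hq0.ne']
  ring

/-- Integration over a countable disjoint union of spheres. -/
lemma integral_spheres (e : ℕ → ℤ) (he : Function.Injective e) (f : ℚ_[p] → ℝ) (c : ℕ → ℝ)
    (hf : ∀ j y, ‖y‖ = (p : ℝ) ^ (e j) → f y = c j)
    (hs : Summable fun j => (p : ℝ) ^ (e j) * c j) :
    IntegrableOn f (⋃ j, sphere (0 : ℚ_[p]) ((p : ℝ) ^ (e j))) (padicHaar p) ∧
    ∫ y in ⋃ j, sphere (0 : ℚ_[p]) ((p : ℝ) ^ (e j)), f y ∂(padicHaar p) =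
      (1 - 1 / p) * ∑' j, (p : ℝ) ^ (e j) * c j := by
  have hq := q_gt_one p
  have hq0 : (0 : ℝ) < p := by linarith
  have hm : ∀ j, MeasurableSet (sphere (0 : ℚ_[p]) ((p : ℝ) ^ (e j))) :=
    fun j => isClosed_sphere.measurableSet
  have hfin : ∀ j, padicHaar p (sphere (0 : ℚ_[p]) ((p : ℝ) ^ (e j))) ≠ ⊤ :=
    fun j => (isCompact_sphere _ _).measure_lt_top.ne
  have heq : ∀ j, Set.EqOn f (fun _ => c j) (sphere (0 : ℚ_[p]) ((p : ℝ) ^ (e j))) :=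
    fun j y hy => hf j y (by simpa using hy)
  have hi : IntegrableOn f (⋃ j, sphere (0 : ℚ_[p]) ((p : ℝ) ^ (e j))) (padicHaar p) := by
    refine integrableOn_iUnion_of_summable_integral_norm (fun j => ?_) ?_
    · exact (integrableOn_congr_fun (heq j) (hm j)).2 (integrableOn_const (hfin j))
    · have : ∀ j, ∫ y in sphere (0 : ℚ_[p]) ((p : ℝ) ^ (e j)), ‖f y‖ ∂(padicHaar p) =
          (1 - 1 / p) * |(p : ℝ) ^ (e j) * c j| := by
        intro j
        rw [setIntegral_congr_fun (hm j) (fun y hy => by simp [heq j hy] :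
          Set.EqOn (fun y => ‖f y‖) (fun _ => ‖c j‖) _), setIntegral_const, haar_sphere,
          abs_mul, abs_of_pos (zpow_pos hq0 _), smul_eq_mul, Real.norm_eq_abs, mul_assoc]
      simp_rw [this]
      exact hs.abs.mul_left _
  refine ⟨hi, ?_⟩
  rw [integral_iUnion hm ?_ hi, ← tsum_mul_left]
  · refine tsum_congr fun j => ?_
    rw [setIntegral_congr_fun (hm j) (heq j), setIntegral_const, haar_sphere, smul_eq_mul, mul_assoc]
  · intro i j hij
    refine Set.disjoint_left.2 fun y h1 h2 => hij (he ?_)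
    simp only [mem_sphere, dist_zero_right] at h1 h2
    exact zpow_right_injective₀ hq0 hq.ne' (h1.symm.trans h2)

lemma integral_ball (n : ℤ) (f : ℚ_[p] → ℝ) (c : ℤ → ℝ)
    (hf : ∀ k y, k < n → ‖y‖ = (p : ℝ) ^ k → f y = c k)
    (hs : Summable fun j : ℕ => (p : ℝ) ^ (n - 1 - j : ℤ) * c (n - 1 - j)) :
    IntegrableOn f (ball (0 : ℚ_[p]) ((p : ℝ) ^ n)) (padicHaar p) ∧
    ∫ y in ball (0 : ℚ_[p]) ((p : ℝ) ^ n), f y ∂(padicHaar p) =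
      (1 - 1 / p) * ∑' j : ℕ, (p : ℝ) ^ (n - 1 - j : ℤ) * c (n - 1 - j) := by
  have hq := q_gt_one p
  have hq0 : (0 : ℝ) < p := by linarith
  have key := integral_spheres p (fun j : ℕ => n - 1 - j) (fun i j h => by simpa using h) f
    (fun j => c (n - 1 - j)) (fun j y h => hf _ y (by lia) h) hs
  have hset : (ball (0 : ℚ_[p]) ((p : ℝ) ^ n)) =ᵐ[padicHaar p]
      (⋃ j : ℕ, sphere (0 : ℚ_[p]) ((p : ℝ) ^ (n - 1 - j : ℤ)) : Set _) := by
    have h0 : ∀ᵐ y ∂(padicHaar p), y ≠ 0 := by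
      rw [ae_iff]; simpa using haar_null p 0
    filter_upwards [h0] with y hy
    obtain ⟨k, hk⟩ := padic_exists_norm p hy
    apply propext
    change y ∈ ball (0 : ℚ_[p]) ((p : ℝ) ^ n) ↔ y ∈ ⋃ j : ℕ, sphere (0 : ℚ_[p]) ((p : ℝ) ^ (n - 1 - j : ℤ))
    simp only [mem_ball, dist_zero_right, Set.mem_iUnion, mem_sphere, hk]
    rw [zpow_lt_zpow_iff_right₀ hq]
    constructor
    · intro h
      exact ⟨(n - 1 - k).toNat, by congr 1; lia⟩
    · rintro ⟨j, hj⟩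
      have := zpow_right_injective₀ hq0 hq.ne' hj
      lia
  rw [setIntegral_congr_set hset]
  exact ⟨key.1.congr_set_ae hset, key.2⟩

lemma integral_ext (n : ℤ) (f : ℚ_[p] → ℝ) (c : ℤ → ℝ)
    (hf : ∀ k y, n < k → ‖y‖ = (p : ℝ) ^ k → f y = c k)
    (hs : Summable fun j : ℕ => (p : ℝ) ^ (n + 1 + j : ℤ) * c (n + 1 + j)) :
    IntegrableOn f (closedBall (0 : ℚ_[p]) ((p : ℝ) ^ n))ᶜ (padicHaar p) ∧
    ∫ y in (closedBall (0 : ℚ_[p]) ((p : ℝ) ^ n))ᶜ, f y ∂(padicHaar p) =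
      (1 - 1 / p) * ∑' j : ℕ, (p : ℝ) ^ (n + 1 + j : ℤ) * c (n + 1 + j) := by
  have hq := q_gt_one p
  have hq0 : (0 : ℝ) < p := by linarith
  have key := integral_spheres p (fun j : ℕ => n + 1 + j) (fun i j h => by simpa using h) f
    (fun j => c (n + 1 + j)) (fun j y h => hf _ y (by lia) h) hs
  have hset : (closedBall (0 : ℚ_[p]) ((p : ℝ) ^ n))ᶜ =
      (⋃ j : ℕ, sphere (0 : ℚ_[p]) ((p : ℝ) ^ (n + 1 + j : ℤ)) : Set _) := by
    ext y
    simp only [Set.mem_compl_iff, mem_closedBall, dist_zero_right, Set.mem_iUnion, mem_sphere, not_le]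
    constructor
    · intro h
      have hy : y ≠ 0 := by
        rintro rfl
        rw [norm_zero] at h
        exact absurd h (not_lt.2 (by positivity))
      obtain ⟨k, hk⟩ := padic_exists_norm p hy
      rw [hk, zpow_lt_zpow_iff_right₀ hq] at h
      exact ⟨(k - n - 1).toNat, by rw [hk]; congr 1; lia⟩
    · rintro ⟨j, hj⟩
      rw [hj, zpow_lt_zpow_iff_right₀ hq]
      lia
  rw [hset]
  exact key

lemma norm_sub_ne {x y : ℚ_[p]} (h : ‖x‖ ≠ ‖y‖) : ‖x - y‖ = max ‖x‖ ‖y‖ := by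
  rw [sub_eq_add_neg, Padic.add_eq_max_of_ne (by rwa [norm_neg]), norm_neg]

/-- Integral of a translate of a radial function over a sphere. -/
lemma integral_sphere_sub (n : ℤ) (x : ℚ_[p]) (hx : ‖x‖ = (p : ℝ) ^ n) (h : ℚ_[p] → ℝ) (c : ℤ → ℝ)
    (hf : ∀ k y, k ≤ n → ‖y‖ = (p : ℝ) ^ k → h y = c k)
    (hs : Summable fun j : ℕ => (p : ℝ) ^ (n - 1 - j : ℤ) * c (n - 1 - j)) :
    IntegrableOn (fun y => h (x - y)) (sphere (0 : ℚ_[p]) ((p : ℝ) ^ n)) (padicHaar p) ∧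
    ∫ y in sphere (0 : ℚ_[p]) ((p : ℝ) ^ n), h (x - y) ∂(padicHaar p) =
      (1 - 1 / p) * (∑' j : ℕ, (p : ℝ) ^ (n - 1 - j : ℤ) * c (n - 1 - j)) +
      (1 - 2 / p) * (p : ℝ) ^ n * c n := by
  have hq := q_gt_one p
  have hq0 : (0 : ℝ) < p := by linarith
  obtain ⟨hb, hbi⟩ := integral_ball p n h c (fun k y hk => hf k y hk.le) hs
  have hms : MeasurableSet (sphere (0 : ℚ_[p]) ((p : ℝ) ^ n)) := isClosed_sphere.measurableSet
  have hfin : padicHaar p (sphere (0 : ℚ_[p]) ((p : ℝ) ^ n)) ≠ ⊤ :=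
    (isCompact_sphere _ _).measure_lt_top.ne
  have heq : Set.EqOn h (fun _ => c n) (sphere (0 : ℚ_[p]) ((p : ℝ) ^ n)) :=
    fun y hy => hf n y le_rfl (by simpa using hy)
  have hsph : IntegrableOn h (sphere (0 : ℚ_[p]) ((p : ℝ) ^ n)) (padicHaar p) :=
    (integrableOn_congr_fun heq hms).2 (integrableOn_const hfin)
  have hcl : IntegrableOn h (closedBall (0 : ℚ_[p]) ((p : ℝ) ^ n)) (padicHaar p) := by
    rw [← ball_union_sphere]; exact hb.union hsph
  have hdis : Disjoint (ball (0 : ℚ_[p]) ((p : ℝ) ^ n)) (sphere 0 ((p : ℝ) ^ n)) :=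
    (sphere_disjoint_ball).symm
  have hcli : ∫ y in closedBall (0 : ℚ_[p]) ((p : ℝ) ^ n), h y ∂(padicHaar p) =
      (1 - 1 / p) * (∑' j : ℕ, (p : ℝ) ^ (n - 1 - j : ℤ) * c (n - 1 - j)) +
      (1 - 1 / p) * (p : ℝ) ^ n * c n := by
    rw [← ball_union_sphere, setIntegral_union hdis hms hb hsph, hbi, setIntegral_congr_fun hms heq,
      setIntegral_const, haar_sphere, smul_eq_mul]
  -- the image set
  have hsub : ball x ((p : ℝ) ^ n) ⊆ closedBall (0 : ℚ_[p]) ((p : ℝ) ^ n) := by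
    intro z hz
    rw [mem_ball, dist_eq_norm] at hz
    rw [mem_closedBall, dist_zero_right]
    have : z = x + (z - x) := by ring
    rw [this]
    exact (Padic.nonarchimedean _ _).trans (max_le hx.le hz.le)
  have hsub2 : ∀ z ∈ ball x ((p : ℝ) ^ n), ‖z‖ = (p : ℝ) ^ n := by
    intro z hz
    rw [mem_ball, dist_eq_norm] at hz
    have h1 : z = x + (z - x) := by ring
    rw [h1, Padic.add_eq_max_of_ne (by rw [hx]; exact hz.ne'), hx, max_eq_left hz.le]
  have hpre : sphere (0 : ℚ_[p]) ((p : ℝ) ^ n) = (fun y => x - y) ⁻¹'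
      (closedBall (0 : ℚ_[p]) ((p : ℝ) ^ n) \ ball x ((p : ℝ) ^ n)) := by
    ext y
    simp only [mem_sphere, Set.mem_preimage, Set.mem_sdiff, mem_closedBall, mem_ball, dist_eq_norm, sub_zero,
      sub_sub_cancel_left, norm_neg, not_lt]
    constructor
    · intro hy
      refine ⟨?_, hy.ge⟩
      have h0 : x - y = x + -y := by ring
      rw [h0]
      exact (Padic.nonarchimedean _ _).trans (max_le hx.le (by rw [norm_neg]; exact hy.le))
    · rintro ⟨h1, h2⟩
      refine le_antisymm ?_ h2
      have : y = x + -(x - y) := by ring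
      rw [this]
      exact (Padic.nonarchimedean _ _).trans (max_le hx.le (by rw [norm_neg]; exact h1))
  have hmp := (padicHaar p).measurePreserving_sub_left x
  have hemb : MeasurableEmbedding (fun y : ℚ_[p] => x - y) :=
    (Homeomorph.subLeft x).measurableEmbedding
  rw [hpre]
  constructor
  · exact (hmp.integrableOn_comp_preimage hemb).2 (hcl.mono_set Set.sdiff_subset)
  · rw [hmp.setIntegral_preimage_emb hemb, setIntegral_sdiff measurableSet_ball hcl hsub, hcli,
      setIntegral_congr_fun (g := fun _ => c n) measurableSet_ball
        (fun z hz => hf n z le_rfl (hsub2 z hz)), setIntegral_const, haar_ball, smul_eq_mul,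
        zpow_sub_one₀ hq0.ne']
    ring

end measurePart

section operatorPart

variable (p : ℕ) [Fact p.Prime]

lemma I_core (κ : ℚ_[p] → ℝ) (K : ℤ → ℝ) (hκ : ∀ k z, ‖z‖ = (p : ℝ) ^ k → κ z = K k)
    (v : ℚ_[p] → ℝ) (w : ℤ → ℝ) (hw : ∀ k z, ‖z‖ = (p : ℝ) ^ k → v z = w k)
    (n : ℤ) (x : ℚ_[p]) (hx : ‖x‖ = (p : ℝ) ^ n)
    (s0 : Summable fun j : ℕ => (p : ℝ) ^ (n - 1 - j : ℤ))
    (s1 : Summable fun j : ℕ => (p : ℝ) ^ (n - 1 - j : ℤ) * K (n - 1 - j))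
    (s2 : Summable fun j : ℕ => (p : ℝ) ^ (n - 1 - j : ℤ) * w (n - 1 - j))
    (s3 : Summable fun j : ℕ => (p : ℝ) ^ (n - 1 - j : ℤ) * K (n - 1 - j) * w (n - 1 - j)) :
    IntegrableOn (fun y => (κ (x - y) - κ y) * v y) (closedBall 0 ((p : ℝ) ^ n)) (padicHaar p) ∧
    ∫ y in closedBall 0 ((p : ℝ) ^ n), (κ (x - y) - κ y) * v y ∂(padicHaar p) =
      (1 - 1 / p) * ((K n * ∑' j : ℕ, (p : ℝ) ^ (n - 1 - j : ℤ) * w (n - 1 - j)) -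
        (∑' j : ℕ, (p : ℝ) ^ (n - 1 - j : ℤ) * K (n - 1 - j) * w (n - 1 - j)) +
        w n * ((∑' j : ℕ, (p : ℝ) ^ (n - 1 - j : ℤ) * K (n - 1 - j)) -
          K n * ∑' j : ℕ, (p : ℝ) ^ (n - 1 - j : ℤ))) := by
  have hq := q_gt_one p
  have hq0 : (0 : ℝ) < p := by linarith
  have e1 : ∀ j : ℕ, (p : ℝ) ^ (n - 1 - j : ℤ) * ((K n - K (n - 1 - j)) * w (n - 1 - j)) =
      K n * ((p : ℝ) ^ (n - 1 - j : ℤ) * w (n - 1 - j)) -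
        (p : ℝ) ^ (n - 1 - j : ℤ) * K (n - 1 - j) * w (n - 1 - j) := fun j => by ring
  have e2 : ∀ j : ℕ, (p : ℝ) ^ (n - 1 - j : ℤ) * ((K (n - 1 - j) - K n) * w n) =
      w n * ((p : ℝ) ^ (n - 1 - j : ℤ) * K (n - 1 - j) - K n * (p : ℝ) ^ (n - 1 - j : ℤ)) :=
    fun j => by ring
  obtain ⟨b1, b2⟩ := integral_ball p n (fun y => (κ (x - y) - κ y) * v y)
    (fun k => (K n - K k) * w k) (by
      intro k y hk hy
      have hlt : ‖y‖ < ‖x‖ := by rw [hx, hy]; exact zpow_lt_zpow_right₀ hq hk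
      have : ‖x - y‖ = (p : ℝ) ^ n := by
        rw [norm_sub_ne p hlt.ne', max_eq_left hlt.le, hx]
      simp only [hκ _ _ this, hκ _ _ hy, hw _ _ hy]) (by
      simp_rw [e1]; exact (s2.mul_left _).sub s3)
  obtain ⟨c1, c2⟩ := integral_sphere_sub p n x hx (fun z => (κ z - K n) * w n)
    (fun k => (K k - K n) * w n) (by
      intro k y _ hy
      simp only [hκ _ _ hy]) (by
      simp_rw [e2]; exact (s1.sub (s0.mul_left _)).mul_left _)
  have hms : MeasurableSet (sphere (0 : ℚ_[p]) ((p : ℝ) ^ n)) := isClosed_sphere.measurableSet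
  have heq : Set.EqOn (fun y => (κ (x - y) - κ y) * v y) (fun y => (κ (x - y) - K n) * w n)
      (sphere (0 : ℚ_[p]) ((p : ℝ) ^ n)) := by
    intro y hy
    rw [mem_sphere, dist_zero_right] at hy
    simp only [hκ _ _ hy, hw _ _ hy]
  have d1 := (integrableOn_congr_fun heq hms).2 c1
  have hdis : Disjoint (ball (0 : ℚ_[p]) ((p : ℝ) ^ n)) (sphere 0 ((p : ℝ) ^ n)) :=
    (sphere_disjoint_ball).symm
  rw [← ball_union_sphere]
  refine ⟨b1.union d1, ?_⟩
  rw [setIntegral_union hdis hms b1 d1, b2, setIntegral_congr_fun hms heq, c2]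
  simp_rw [e1, e2]
  rw [(s2.mul_left _).tsum_sub s3, tsum_mul_left, tsum_mul_left, s1.tsum_sub (s0.mul_left _),
    tsum_mul_left]
  ring

lemma D_core (α a : ℝ) (ha : ∀ k : ℤ, ((p : ℝ) ^ k) ^ (-α - 1) = ((a * p) ^ k)⁻¹)
    (ha0 : a ≠ 0)
    (u : ℚ_[p] → ℝ) (U : ℤ → ℝ) (hu : ∀ k z, ‖z‖ = (p : ℝ) ^ k → u z = U k)
    (n : ℤ) (x : ℚ_[p]) (hx : ‖x‖ = (p : ℝ) ^ n)
    (s0 : Summable fun j : ℕ => (p : ℝ) ^ (n - 1 - j : ℤ))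
    (s1 : Summable fun j : ℕ => (p : ℝ) ^ (n - 1 - j : ℤ) * U (n - 1 - j))
    (s2 : Summable fun j : ℕ => (a ^ (n + 1 + j : ℤ))⁻¹)
    (s3 : Summable fun j : ℕ => (a ^ (n + 1 + j : ℤ))⁻¹ * U (n + 1 + j)) :
    Integrable (Dker p α u x) (padicHaar p) ∧
    ∫ y, Dker p α u x y ∂(padicHaar p) =
      (1 - 1 / p) * (((a * p) ^ n)⁻¹ * ((∑' j : ℕ, (p : ℝ) ^ (n - 1 - j : ℤ) * U (n - 1 - j)) -
          U n * ∑' j : ℕ, (p : ℝ) ^ (n - 1 - j : ℤ)) +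
        ((∑' j : ℕ, (a ^ (n + 1 + j : ℤ))⁻¹ * U (n + 1 + j)) -
          U n * ∑' j : ℕ, (a ^ (n + 1 + j : ℤ))⁻¹)) := by
  have hq := q_gt_one p
  have hq0 : (0 : ℝ) < p := by linarith
  have hux : u x = U n := hu _ _ hx
  have e1 : ∀ j : ℕ, (p : ℝ) ^ (n - 1 - j : ℤ) * (((a * p) ^ n)⁻¹ * (U (n - 1 - j) - U n)) =
      ((a * p) ^ n)⁻¹ * ((p : ℝ) ^ (n - 1 - j : ℤ) * U (n - 1 - j) -
        U n * (p : ℝ) ^ (n - 1 - j : ℤ)) := fun j => by ring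
  have e2 : ∀ j : ℕ, (p : ℝ) ^ (n + 1 + j : ℤ) *
      (((a * p) ^ (n + 1 + j : ℤ))⁻¹ * (U (n + 1 + j) - U n)) =
      (a ^ (n + 1 + j : ℤ))⁻¹ * U (n + 1 + j) - U n * (a ^ (n + 1 + j : ℤ))⁻¹ := by
    intro j
    rw [mul_zpow]
    have : (p : ℝ) ^ (n + 1 + j : ℤ) ≠ 0 := (zpow_pos hq0 _).ne'
    have : a ^ (n + 1 + j : ℤ) ≠ 0 := zpow_ne_zero _ ha0
    field_simp
  obtain ⟨b1, b2⟩ := integral_ball p n (Dker p α u x) (fun _ => 0) (by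
      intro k y hk hy
      have hlt : ‖y‖ < ‖x‖ := by rw [hx, hy]; exact zpow_lt_zpow_right₀ hq hk
      have : ‖x - y‖ = (p : ℝ) ^ n := by
        rw [norm_sub_ne p hlt.ne', max_eq_left hlt.le, hx]
      simp only [Dker, hu _ _ this, hux, sub_self, mul_zero]) (by simp [summable_zero])
  obtain ⟨c1, c2⟩ := integral_sphere_sub p n x hx (fun z => ((a * p) ^ n)⁻¹ * (u z - U n))
    (fun k => ((a * p) ^ n)⁻¹ * (U k - U n)) (by
      intro k y _ hy
      simp only [hu _ _ hy]) (by
      simp_rw [e1]; exact (s1.sub (s0.mul_left _)).mul_left _)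
  obtain ⟨d1, d2⟩ := integral_ext p n (Dker p α u x)
    (fun k => ((a * p) ^ k)⁻¹ * (U k - U n)) (by
      intro k y hk hy
      have hlt : ‖x‖ < ‖y‖ := by rw [hx, hy]; exact zpow_lt_zpow_right₀ hq hk
      have : ‖x - y‖ = (p : ℝ) ^ k := by
        rw [norm_sub_ne p hlt.ne, max_eq_right hlt.le, hy]
      simp only [Dker, hu _ _ this, hux, hy, ha]) (by
      simp_rw [e2]; exact s3.sub (s2.mul_left _))
  have hms : MeasurableSet (sphere (0 : ℚ_[p]) ((p : ℝ) ^ n)) := isClosed_sphere.measurableSet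
  have heq : Set.EqOn (Dker p α u x) (fun y => ((a * p) ^ n)⁻¹ * (u (x - y) - U n))
      (sphere (0 : ℚ_[p]) ((p : ℝ) ^ n)) := by
    intro y hy
    rw [mem_sphere, dist_zero_right] at hy
    simp only [Dker, hy, ha, hux]
  have f1 := (integrableOn_congr_fun heq hms).2 c1
  have hdis : Disjoint (ball (0 : ℚ_[p]) ((p : ℝ) ^ n)) (sphere 0 ((p : ℝ) ^ n)) :=
    (sphere_disjoint_ball).symm
  have g1 := b1.union f1
  rw [ball_union_sphere] at g1
  have hmc : MeasurableSet (closedBall (0 : ℚ_[p]) ((p : ℝ) ^ n)) :=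
    isClosed_closedBall.measurableSet
  have hint : Integrable (Dker p α u x) (padicHaar p) := by
    rw [← integrableOn_univ, ← Set.union_compl_self (closedBall (0 : ℚ_[p]) ((p : ℝ) ^ n))]
    exact g1.union d1
  refine ⟨hint, ?_⟩
  rw [← integral_add_compl hmc hint, d2]
  rw [← ball_union_sphere, setIntegral_union hdis hms b1 f1, b2, setIntegral_congr_fun hms heq, c2]
  simp_rw [e1, e2]
  rw [tsum_mul_left, s1.tsum_sub (s0.mul_left _), s3.tsum_sub (s2.mul_left _),
    tsum_mul_left, tsum_mul_left]
  simp
  ring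

end operatorPart

section seriesPart

lemma HasSum.congr_fun' {f g : ℕ → ℝ} {s : ℝ} (h : HasSum f s) (e : ∀ j, g j = f j) :
    HasSum g s := by
  rw [funext e]; exact h

lemma summ_down {w : ℤ → ℝ} {m : ℤ} (h : Summable fun j : ℕ => w (m - j)) (n : ℤ) :
    Summable fun j : ℕ => w (n - j) := by
  rcases le_total n m with hnm | hnm
  · obtain ⟨d, hd⟩ := Int.eq_ofNat_of_zero_le (sub_nonneg.2 hnm)
    have := (summable_nat_add_iff d).2 h
    refine this.congr fun j => ?_
    congr 1; push_cast; lia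
  · obtain ⟨d, hd⟩ := Int.eq_ofNat_of_zero_le (sub_nonneg.2 hnm)
    rw [← summable_nat_add_iff d]
    refine h.congr fun j => ?_
    congr 1; push_cast; lia

lemma summ_up {w : ℤ → ℝ} {m : ℤ} (h : Summable fun j : ℕ => w (m + j)) (n : ℤ) :
    Summable fun j : ℕ => w (n + j) := by
  have h' : Summable fun j : ℕ => (fun k => w (-k)) (-m - j) := by
    refine h.congr fun j => ?_
    exact congrArg w (by ring)
  refine (summ_down (w := fun k => w (-k)) (m := -m) h' (-n)).congr fun j => ?_
  exact congrArg w (by ring)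

/-- Sum of a two-sided sequence over indices below `n`. -/
noncomputable def lowSum (w : ℤ → ℝ) (n : ℤ) : ℝ := ∑' j : ℕ, w (n - 1 - j)

lemma lowSum_succ {w : ℤ → ℝ} (h : ∀ n : ℤ, Summable fun j : ℕ => w (n - j)) (n : ℤ) :
    lowSum w (n + 1) = lowSum w n + w n := by
  unfold lowSum
  have e : ∀ j : ℕ, w (n + 1 - 1 - j) = w (n - j) := fun j => by congr 1; ring
  simp_rw [e]
  rw [(h n).tsum_eq_zero_add, add_comm]
  congr 1
  · refine tsum_congr fun j => ?_
    congr 1; push_cast; ring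
  · simp

lemma lowSum_bdd {w : ℤ → ℝ} (h : ∀ n : ℤ, Summable fun j : ℕ => w (n - j)) (n : ℤ) (i : ℕ) :
    |lowSum w (n - 1 - i)| ≤ ∑' j : ℕ, |w (n - 1 - j)| := by
  unfold lowSum
  have h1 := (h (n - 1 - i - 1)).abs
  have h2 := (h (n - 1)).abs
  have h3 : |∑' j : ℕ, w (n - 1 - i - 1 - j)| ≤ ∑' j : ℕ, |w (n - 1 - i - 1 - j)| := by
    have := norm_tsum_le_tsum_norm (f := fun j : ℕ => w (n - 1 - i - 1 - j)) h1
    simpa [Real.norm_eq_abs] using this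
  refine h3.trans ?_
  rw [← h2.sum_add_tsum_nat_add (i + 1)]
  refine le_trans (le_of_eq ?_) (le_add_of_nonneg_left (Finset.sum_nonneg fun _ _ => abs_nonneg _))
  refine tsum_congr fun j => ?_
  congr 2; push_cast; ring

lemma geo_down {ρ : ℝ} (hρ : 1 < ρ) (n : ℤ) :
    HasSum (fun j : ℕ => ρ ^ (n - 1 - j : ℤ)) (ρ ^ n / (ρ - 1)) := by
  have h0 : ρ ≠ 0 := by linarith
  have := (hasSum_geometric_of_lt_one (inv_nonneg.2 (by linarith : (0 : ℝ) ≤ ρ))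
    (inv_lt_one_of_one_lt₀ hρ)).mul_left (ρ ^ (n - 1))
  suffices key : ρ ^ n / (ρ - 1) = ρ ^ (n - 1) * (1 - ρ⁻¹)⁻¹ by
    rw [key]
    refine this.congr_fun' fun j => ?_
    rw [zpow_sub₀ h0 (n - 1), zpow_natCast, inv_pow]; rfl
  have : ρ - 1 ≠ 0 := by linarith
  have h4 : 1 - ρ⁻¹ = (ρ - 1) / ρ := by field_simp
  rw [zpow_sub_one₀ h0, h4]
  field_simp

lemma geo_up {ρ : ℝ} (hρ : 1 < ρ) (n : ℤ) :
    HasSum (fun j : ℕ => (ρ ^ (n + 1 + j : ℤ))⁻¹) ((ρ ^ n)⁻¹ / (ρ - 1)) := by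
  have := geo_down hρ (-n)
  rw [zpow_neg] at this
  convert this using 2 with j
  rw [← zpow_neg]; congr 1; ring

lemma geo_down' {ρ : ℝ} (hρ : 1 < ρ) (n : ℤ) :
    HasSum (fun j : ℕ => ((j : ℝ) + 1) * ρ ^ (n - 1 - j : ℤ)) (ρ ^ n * ρ / (ρ - 1) ^ 2) := by
  have h0 : ρ ≠ 0 := by linarith
  have h1 : ρ - 1 ≠ 0 := by linarith
  have h2 := hasSum_coe_mul_geometric_of_norm_lt_one (r := ρ⁻¹) (by
    rw [Real.norm_of_nonneg (inv_nonneg.2 (by linarith))]; exact inv_lt_one_of_one_lt₀ hρ)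
  have h3 := (h2.mul_left (ρ ^ (n - 1))).add (geo_down hρ n)
  suffices key : ρ ^ n * ρ / (ρ - 1) ^ 2 =
      ρ ^ (n - 1) * (ρ⁻¹ / (1 - ρ⁻¹) ^ 2) + ρ ^ n / (ρ - 1) by
    rw [key]
    refine h3.congr_fun' fun j => ?_
    rw [zpow_sub₀ h0 (n - 1), zpow_natCast, inv_pow, div_eq_mul_inv]; ring
  have h4 : 1 - ρ⁻¹ = (ρ - 1) / ρ := by field_simp
  rw [zpow_sub_one₀ h0, h4]
  field_simp
  ring

lemma down_sum {F e : ℤ → ℝ} {ρ M : ℝ} (hρ : 1 < ρ) (n : ℤ) (hF : ∀ k, F (k + 1) = F k + e k)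
    (hb : ∀ j : ℕ, |F (n - 1 - j)| ≤ M) :
    Summable (fun j : ℕ => ρ ^ (n - 1 - j : ℤ) * F (n - 1 - j)) ∧
    Summable (fun j : ℕ => ρ ^ (n - 1 - j : ℤ) * e (n - 1 - j)) ∧
    (ρ - 1) * ∑' j : ℕ, ρ ^ (n - 1 - j : ℤ) * F (n - 1 - j) =
      ρ ^ n * F n - ρ * ∑' j : ℕ, ρ ^ (n - 1 - j : ℤ) * e (n - 1 - j) := by
  have h0 : 0 < ρ := by linarith
  have hS : Summable (fun j : ℕ => ρ ^ (n - 1 - j : ℤ) * F (n - 1 - j)) := by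
    refine Summable.of_norm_bounded ((geo_down hρ n).summable.mul_right M) fun j => ?_
    rw [norm_mul, Real.norm_of_nonneg (zpow_pos h0 _).le, Real.norm_eq_abs]
    exact mul_le_mul_of_nonneg_left (hb j) (zpow_pos h0 _).le
  have hs' : ∀ j : ℕ, ρ ^ (n - (j + 1 : ℕ) : ℤ) * F (n - (j + 1 : ℕ)) =
      ρ ^ (n - 1 - j : ℤ) * F (n - 1 - j) := by
    intro j
    have : (n - (j + 1 : ℕ) : ℤ) = n - 1 - j := by push_cast; ring
    rw [this]
  have hG : Summable (fun j : ℕ => ρ ^ (n - j : ℤ) * F (n - j)) := by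
    rw [← summable_nat_add_iff 1]
    exact hS.congr fun j => (hs' j).symm
  have hGs : ∑' j : ℕ, ρ ^ (n - j : ℤ) * F (n - j) =
      ρ ^ n * F n + ∑' j : ℕ, ρ ^ (n - 1 - j : ℤ) * F (n - 1 - j) := by
    rw [hG.tsum_eq_zero_add]
    congr 1
    · simp
    · exact tsum_congr hs'
  have he : ∀ j : ℕ, ρ ^ (n - 1 - j : ℤ) * e (n - 1 - j) =
      ρ⁻¹ * (ρ ^ (n - j : ℤ) * F (n - j)) - ρ ^ (n - 1 - j : ℤ) * F (n - 1 - j) := by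
    intro j
    have h1 := hF (n - 1 - j)
    have h2 : (n - 1 - j + 1 : ℤ) = n - j := by ring
    have h3 : ρ ^ (n - j : ℤ) = ρ ^ (n - 1 - j : ℤ) * ρ := by
      rw [← h2, zpow_add_one₀ h0.ne']
    rw [h2] at h1
    rw [h1, h3]
    field_simp
    ring
  have hE : Summable (fun j : ℕ => ρ ^ (n - 1 - j : ℤ) * e (n - 1 - j)) := by
    simp_rw [he]; exact (hG.mul_left _).sub hS
  refine ⟨hS, hE, ?_⟩
  have : ∑' j : ℕ, ρ ^ (n - 1 - j : ℤ) * e (n - 1 - j) =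
      ρ⁻¹ * (∑' j : ℕ, ρ ^ (n - j : ℤ) * F (n - j)) -
        ∑' j : ℕ, ρ ^ (n - 1 - j : ℤ) * F (n - 1 - j) := by
    simp_rw [he]
    rw [(hG.mul_left _).tsum_sub hS, tsum_mul_left]
  rw [this, hGs]
  field_simp
  ring

lemma summable_rec {x d : ℕ → ℝ} {r : ℝ} (hr : r < 1) (hr0 : 0 ≤ r)
    (hx : ∀ j, x (j + 1) = r * x j + d j) (hd : Summable d) : Summable x := by
  have hd' := hd.abs
  rw [← summable_abs_iff]
  refine summable_of_sum_range_le (c := (|x 0| + ∑' j, |d j|) / (1 - r)) (fun _ => abs_nonneg _)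
    fun N => ?_
  rw [le_div_iff₀ (by linarith)]
  have h1 : ∑ i ∈ Finset.range (N + 1), |x i| ≤
      |x 0| + r * ∑ i ∈ Finset.range N, |x i| + ∑' j, |d j| := by
    rw [Finset.sum_range_succ']
    have h2 : ∑ i ∈ Finset.range N, |x (i + 1)| ≤
        ∑ i ∈ Finset.range N, (r * |x i| + |d i|) := by
      refine Finset.sum_le_sum fun i _ => ?_
      rw [hx]
      refine (abs_add_le _ _).trans ?_
      rw [abs_mul, abs_of_nonneg hr0]
    rw [Finset.sum_add_distrib, ← Finset.mul_sum] at h2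
    have h3 := hd'.sum_le_tsum (Finset.range N) (fun _ _ => abs_nonneg _)
    linarith
  have h2 : ∑ i ∈ Finset.range N, |x i| ≤ ∑ i ∈ Finset.range (N + 1), |x i| := by
    rw [Finset.sum_range_succ]
    linarith [abs_nonneg (x N)]
  linarith

lemma up_sum {F e : ℤ → ℝ} {b : ℝ} (hb : 1 < b) (n : ℤ) (hF : ∀ k, F (k + 1) = F k + e k)
    (he : Summable fun j : ℕ => (b ^ (n + 1 + j : ℤ))⁻¹ * e (n + 1 + j)) :
    Summable (fun j : ℕ => (b ^ (n + 1 + j : ℤ))⁻¹ * F (n + 1 + j)) ∧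
    (b - 1) * ∑' j : ℕ, (b ^ (n + 1 + j : ℤ))⁻¹ * F (n + 1 + j) =
      (b ^ n)⁻¹ * F (n + 1) + ∑' j : ℕ, (b ^ (n + 1 + j : ℤ))⁻¹ * e (n + 1 + j) := by
  have h0 : 0 < b := by linarith
  have hrec : ∀ j : ℕ, (b ^ (n + 1 + (j + 1 : ℕ) : ℤ))⁻¹ * F (n + 1 + (j + 1 : ℕ)) =
      b⁻¹ * ((b ^ (n + 1 + j : ℤ))⁻¹ * F (n + 1 + j)) +
      b⁻¹ * ((b ^ (n + 1 + j : ℤ))⁻¹ * e (n + 1 + j)) := by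
    intro j
    have : (n + 1 + (j + 1 : ℕ) : ℤ) = n + 1 + j + 1 := by push_cast; ring
    rw [this, hF, zpow_add_one₀ h0.ne', mul_inv]
    ring
  have hS : Summable (fun j : ℕ => (b ^ (n + 1 + j : ℤ))⁻¹ * F (n + 1 + j)) :=
    summable_rec (inv_lt_one_of_one_lt₀ hb) (inv_nonneg.2 h0.le) hrec (he.mul_left _)
  refine ⟨hS, ?_⟩
  have h1 := hS.tsum_eq_zero_add
  simp_rw [hrec] at h1
  rw [(hS.mul_left _).tsum_add (he.mul_left _), tsum_mul_left, tsum_mul_left] at h1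
  simp only [Nat.cast_zero, add_zero] at h1
  rw [zpow_add_one₀ h0.ne'] at h1
  generalize (∑' j : ℕ, (b ^ (n + 1 + j : ℤ))⁻¹ * F (n + 1 + j)) = S at *
  generalize (∑' j : ℕ, (b ^ (n + 1 + j : ℤ))⁻¹ * e (n + 1 + j)) = E at *
  field_simp at h1 ⊢
  linarith

/-- The target expression for the composition, in the series form. -/
def DSer (q a : ℝ) (U w : ℤ → ℝ) (n : ℤ) : Prop :=
  Summable (fun j : ℕ => q ^ (n - 1 - j : ℤ) * U (n - 1 - j)) ∧
  Summable (fun j : ℕ => (a ^ (n + 1 + j : ℤ))⁻¹ * U (n + 1 + j)) ∧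
  (1 - a) / (1 - (a * q)⁻¹) * ((1 - 1 / q) *
    (((a * q) ^ n)⁻¹ * ((∑' j : ℕ, q ^ (n - 1 - j : ℤ) * U (n - 1 - j)) -
          U n * ∑' j : ℕ, q ^ (n - 1 - j : ℤ)) +
        ((∑' j : ℕ, (a ^ (n + 1 + j : ℤ))⁻¹ * U (n + 1 + j)) -
          U n * ∑' j : ℕ, (a ^ (n + 1 + j : ℤ))⁻¹))) = w n

set_option maxHeartbeats 2000000 in
lemma series_ne {q a : ℝ} (hq : 1 < q) (ha : 1 < a) (haq : a ≠ q) (w : ℤ → ℝ)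
    (hA : ∀ n : ℤ, Summable fun j : ℕ => (fun k : ℤ => q ^ k * w k) (n - j))
    (hB : ∀ n : ℤ, Summable fun j : ℕ => (fun k : ℤ => a ^ k * w k) (n - j))
    (hV : ∀ n : ℤ, Summable fun j : ℕ => w (n + j)) (U : ℤ → ℝ)
    (hU : ∀ n, U n = a ^ n / a * w n + (1 - 1 / a) / (1 - a / q) * (1 - 1 / q) *
      ((a ^ n / q ^ n) * lowSum (fun k : ℤ => q ^ k * w k) n -
        lowSum (fun k : ℤ => a ^ k * w k) n)) (n : ℤ) : DSer q a U w n := by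
  have hq0 : 0 < q := by linarith
  have ha0 : 0 < a := by linarith
  set c := (1 - 1 / a) / (1 - a / q) * (1 - 1 / q) with hc
  set A := lowSum (fun k : ℤ => q ^ k * w k) with hAd
  set B := lowSum (fun k : ℤ => a ^ k * w k) with hBd
  have hA1 : ∀ k, A (k + 1) = A k + q ^ k * w k := fun k => lowSum_succ hA k
  have hB1 : ∀ k, B (k + 1) = B k + a ^ k * w k := fun k => lowSum_succ hB k
  obtain ⟨dA1, dA2, dA3⟩ := down_sum ha n hA1 (lowSum_bdd hA n)
  obtain ⟨dB1, dB2, dB3⟩ := down_sum hq n hB1 (lowSum_bdd hB n)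
  have eA : ∀ j : ℕ, (q ^ (n + 1 + j : ℤ))⁻¹ * (q ^ (n + 1 + j : ℤ) * w (n + 1 + j)) =
      w (n + 1 + j) := fun j => by
    rw [inv_mul_cancel_left₀ (zpow_pos hq0 _).ne']
  have eB : ∀ j : ℕ, (a ^ (n + 1 + j : ℤ))⁻¹ * (a ^ (n + 1 + j : ℤ) * w (n + 1 + j)) =
      w (n + 1 + j) := fun j => by
    rw [inv_mul_cancel_left₀ (zpow_pos ha0 _).ne']
  obtain ⟨uA1, uA2⟩ := up_sum hq n hA1 (by simp_rw [eA]; exact hV _)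
  obtain ⟨uB1, uB2⟩ := up_sum ha n hB1 (by simp_rw [eB]; exact hV _)
  simp_rw [eA] at uA2
  simp_rw [eB] at uB2
  have e1 : ∀ j : ℕ, q ^ (n - 1 - j : ℤ) * U (n - 1 - j) =
      a⁻¹ * (q ^ (n - 1 - j : ℤ) * (a ^ (n - 1 - j : ℤ) * w (n - 1 - j))) +
      c * (a ^ (n - 1 - j : ℤ) * A (n - 1 - j) - q ^ (n - 1 - j : ℤ) * B (n - 1 - j)) := by
    intro j
    rw [hU]
    have := (zpow_pos hq0 (n - 1 - j : ℤ)).ne'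
    field_simp
  have e2 : ∀ j : ℕ, (a ^ (n + 1 + j : ℤ))⁻¹ * U (n + 1 + j) =
      a⁻¹ * w (n + 1 + j) +
      c * ((q ^ (n + 1 + j : ℤ))⁻¹ * A (n + 1 + j) - (a ^ (n + 1 + j : ℤ))⁻¹ * B (n + 1 + j)) := by
    intro j
    rw [hU]
    have := (zpow_pos hq0 (n + 1 + j : ℤ)).ne'
    have := (zpow_pos ha0 (n + 1 + j : ℤ)).ne'
    field_simp
  have eE : ∀ j : ℕ, a ^ (n - 1 - j : ℤ) * (q ^ (n - 1 - j : ℤ) * w (n - 1 - j)) =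
    q ^ (n - 1 - j : ℤ) * (a ^ (n - 1 - j : ℤ) * w (n - 1 - j)) := fun j => by ring
  simp_rw [eE] at dA3
  unfold DSer
  rw [(geo_down hq n).tsum_eq, (geo_up ha n).tsum_eq]
  simp_rw [e1, e2]
  refine ⟨(dB2.mul_left _).add ((dA1.sub dB1).mul_left _),
    ((hV _).mul_left _).add ((uA1.sub uB1).mul_left _), ?_⟩
  rw [(dB2.mul_left _).tsum_add ((dA1.sub dB1).mul_left _),
    ((hV _).mul_left _).tsum_add ((uA1.sub uB1).mul_left _), tsum_mul_left, tsum_mul_left,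
    tsum_mul_left, tsum_mul_left, dA1.tsum_sub dB1, uA1.tsum_sub uB1, hU, mul_zpow]
  rw [hA1] at uA2
  rw [hB1] at uB2
  generalize (∑' j : ℕ, q ^ (n - 1 - j : ℤ) * (a ^ (n - 1 - j : ℤ) * w (n - 1 - j))) = E at *
  generalize (∑' j : ℕ, a ^ (n - 1 - j : ℤ) * A (n - 1 - j)) = SA at *
  generalize (∑' j : ℕ, q ^ (n - 1 - j : ℤ) * B (n - 1 - j)) = SB at *
  generalize (∑' j : ℕ, (q ^ (n + 1 + j : ℤ))⁻¹ * A (n + 1 + j)) = TA at *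
  generalize (∑' j : ℕ, (a ^ (n + 1 + j : ℤ))⁻¹ * B (n + 1 + j)) = TB at *
  generalize (∑' j : ℕ, w (n + 1 + j)) = V at *
  have hQ := zpow_pos hq0 n
  have hR := zpow_pos ha0 n
  generalize q ^ n = Q at *
  generalize a ^ n = R at *
  generalize A n = An at *
  generalize B n = Bn at *
  generalize w n = wn at *
  have n1 : a - 1 ≠ 0 := by linarith
  have n2 : q - 1 ≠ 0 := by linarith
  have n3 : q - a ≠ 0 := fun h => haq (by linarith)
  have n4 : a * q - 1 ≠ 0 := by nlinarith
  have f1 : SA = (R * An - a * E) / (a - 1) := by field_simp; linarith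
  have f2 : SB = (Q * Bn - q * E) / (q - 1) := by field_simp; linarith
  have f3 : TA = (Q⁻¹ * (An + Q * wn) + V) / (q - 1) := by
    rw [eq_div_iff n2]; linarith
  have f4 : TB = (R⁻¹ * (Bn + R * wn) + V) / (a - 1) := by
    rw [eq_div_iff n1]; linarith
  have fc : c = (a - 1) * (q - 1) / (a * (q - a)) := by
    rw [hc]
    have : 1 - a / q = (q - a) / q := by field_simp
    rw [this]; field_simp
  have fd : (1 - a) / (1 - (a * q)⁻¹) = - (a - 1) * (a * q) / (a * q - 1) := by
    have : 1 - (a * q)⁻¹ = (a * q - 1) / (a * q) := by field_simp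
    rw [this]; field_simp; ring
  clear_value c
  rw [f1, f2, f3, f4, fc, fd]
  field_simp
  ring

set_option maxHeartbeats 2000000 in
lemma series_one {q : ℝ} (hq : 1 < q) (w : ℤ → ℝ) (C : ℤ → ℝ)
    (hA : ∀ n : ℤ, Summable fun j : ℕ => (fun k : ℤ => q ^ k * w k) (n - j))
    (hC1 : ∀ n, C (n + 1) = C n + (lowSum (fun k : ℤ => q ^ k * w k) n + q ^ n * w n))
    (hCb : ∀ n : ℤ, ∃ M, ∀ j : ℕ, |C (n - 1 - j)| ≤ M)
    (hV : ∀ n : ℤ, Summable fun j : ℕ => w (n + j)) (U : ℤ → ℝ)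
    (hU : ∀ n, U n = q ^ n / q * w n - (q - 1) ^ 2 / q ^ 2 * C n) (n : ℤ) : DSer q q U w n := by
  have hq0 : 0 < q := by linarith
  set A := lowSum (fun k : ℤ => q ^ k * w k) with hAd
  have hA1 : ∀ k, A (k + 1) = A k + q ^ k * w k := fun k => lowSum_succ hA k
  obtain ⟨dA1, dA2, dA3⟩ := down_sum hq n hA1 (lowSum_bdd hA n)
  obtain ⟨M, hM⟩ := hCb n
  obtain ⟨dC1, dC2, dC3⟩ := down_sum (e := fun k => A k + q ^ k * w k) hq n hC1 hM
  have eA : ∀ j : ℕ, (q ^ (n + 1 + j : ℤ))⁻¹ * (q ^ (n + 1 + j : ℤ) * w (n + 1 + j)) =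
      w (n + 1 + j) := fun j => by
    rw [inv_mul_cancel_left₀ (zpow_pos hq0 _).ne']
  obtain ⟨uA1, uA2⟩ := up_sum hq n hA1 (by simp_rw [eA]; exact hV _)
  simp_rw [eA] at uA2
  have eC : ∀ j : ℕ, (q ^ (n + 1 + j : ℤ))⁻¹ * (A (n + 1 + j) + q ^ (n + 1 + j : ℤ) * w (n + 1 + j)) =
      (q ^ (n + 1 + j : ℤ))⁻¹ * A (n + 1 + j) + w (n + 1 + j) := fun j => by
    rw [mul_add, eA]
  obtain ⟨uC1, uC2⟩ := up_sum (e := fun k => A k + q ^ k * w k) hq n hC1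
    (by simp_rw [eC]; exact uA1.add (hV _))
  simp_rw [eC] at uC2
  rw [uA1.tsum_add (hV _)] at uC2
  simp_rw [mul_add] at dC3
  rw [dA1.tsum_add dA2] at dC3
  have e1 : ∀ j : ℕ, q ^ (n - 1 - j : ℤ) * U (n - 1 - j) =
      q⁻¹ * (q ^ (n - 1 - j : ℤ) * (q ^ (n - 1 - j : ℤ) * w (n - 1 - j))) -
      (q - 1) ^ 2 / q ^ 2 * (q ^ (n - 1 - j : ℤ) * C (n - 1 - j)) := by
    intro j
    rw [hU]
    ring
  have e2 : ∀ j : ℕ, (q ^ (n + 1 + j : ℤ))⁻¹ * U (n + 1 + j) =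
      q⁻¹ * w (n + 1 + j) -
      (q - 1) ^ 2 / q ^ 2 * ((q ^ (n + 1 + j : ℤ))⁻¹ * C (n + 1 + j)) := by
    intro j
    rw [hU]
    have := (zpow_pos hq0 (n + 1 + j : ℤ)).ne'
    field_simp
  unfold DSer
  rw [(geo_down hq n).tsum_eq, (geo_up hq n).tsum_eq]
  simp_rw [e1, e2]
  refine ⟨(dA2.mul_left _).sub (dC1.mul_left _), ((hV _).mul_left _).sub (uC1.mul_left _), ?_⟩
  rw [(dA2.mul_left _).tsum_sub (dC1.mul_left _), ((hV _).mul_left _).tsum_sub (uC1.mul_left _),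
    tsum_mul_left, tsum_mul_left, tsum_mul_left, tsum_mul_left, hU, mul_zpow]
  rw [hA1] at uA2
  rw [hC1] at uC2
  generalize (∑' j : ℕ, q ^ (n - 1 - j : ℤ) * (q ^ (n - 1 - j : ℤ) * w (n - 1 - j))) = E at *
  generalize (∑' j : ℕ, q ^ (n - 1 - j : ℤ) * A (n - 1 - j)) = SA at *
  generalize (∑' j : ℕ, q ^ (n - 1 - j : ℤ) * C (n - 1 - j)) = SC at *
  generalize (∑' j : ℕ, (q ^ (n + 1 + j : ℤ))⁻¹ * A (n + 1 + j)) = TA at *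
  generalize (∑' j : ℕ, (q ^ (n + 1 + j : ℤ))⁻¹ * C (n + 1 + j)) = TC at *
  generalize (∑' j : ℕ, w (n + 1 + j)) = V at *
  have hQ := zpow_pos hq0 n
  generalize q ^ n = Q at *
  generalize A n = An at *
  generalize C n = Cn at *
  generalize w n = wn at *
  have n2 : q - 1 ≠ 0 := by linarith
  have n4 : q ^ 2 - 1 ≠ 0 := by nlinarith
  have f1 : SA = (Q * An - q * E) / (q - 1) := by field_simp; linarith
  have f2 : SC = (Q * Cn - q * (SA + E)) / (q - 1) := by
    rw [eq_div_iff n2]; linarith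
  have f3 : TA = (Q⁻¹ * (An + Q * wn) + V) / (q - 1) := by
    rw [eq_div_iff n2]; linarith
  have f4 : TC = (Q⁻¹ * (Cn + (An + Q * wn)) + (TA + V)) / (q - 1) := by
    rw [eq_div_iff n2]; linarith
  have fd : (1 - q) / (1 - (q * q)⁻¹) = - (q - 1) * q ^ 2 / (q ^ 2 - 1) := by
    have : 1 - (q * q)⁻¹ = (q ^ 2 - 1) / (q ^ 2) := by field_simp
    rw [this]; field_simp; ring
  rw [f2, f4, f1, f3, fd]
  field_simp
  ring

end seriesPart

section finalPart

lemma final_core (p : ℕ) [Fact p.Prime] (α a : ℝ) (hα : 0 < α) (ha : a = (p : ℝ) ^ α)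
    (κ : ℚ_[p] → ℝ) (K : ℤ → ℝ) (hκ : ∀ k z, ‖z‖ = (p : ℝ) ^ k → κ z = K k)
    (hI : ∀ x y, Iker p α x y = κ (x - y) - κ y)
    (v : ℚ_[p] → ℝ) (w : ℤ → ℝ) (hw : ∀ k z, ‖z‖ = (p : ℝ) ^ k → v z = w k)
    (s1 : ∀ n : ℤ, Summable fun j : ℕ => (p : ℝ) ^ (n - 1 - j : ℤ) * K (n - 1 - j))
    (s2 : ∀ n : ℤ, Summable fun j : ℕ => (p : ℝ) ^ (n - 1 - j : ℤ) * w (n - 1 - j))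
    (s3 : ∀ n : ℤ, Summable fun j : ℕ => (p : ℝ) ^ (n - 1 - j : ℤ) * K (n - 1 - j) * w (n - 1 - j))
    (U : ℤ → ℝ)
    (hU : ∀ n : ℤ, U n = Icoef p α *
      ((1 - 1 / p) * ((K n * ∑' j : ℕ, (p : ℝ) ^ (n - 1 - j : ℤ) * w (n - 1 - j)) -
        (∑' j : ℕ, (p : ℝ) ^ (n - 1 - j : ℤ) * K (n - 1 - j) * w (n - 1 - j)) +
        w n * ((∑' j : ℕ, (p : ℝ) ^ (n - 1 - j : ℤ) * K (n - 1 - j)) -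
          K n * ∑' j : ℕ, (p : ℝ) ^ (n - 1 - j : ℤ)))))
    (hD : ∀ n, DSer p a U w n) :
    (∀ z : ℚ_[p], IntegrableOn (fun y => Iker p α z y * v y) {y : ℚ_[p] | ‖y‖ ≤ ‖z‖}
      (padicHaar p)) ∧
    ∀ x : ℚ_[p], x ≠ 0 →
      Integrable (Dker p α (Iop p α v) x) (padicHaar p) ∧
      Dop p α (Iop p α v) x = v x := by
  have hq := q_gt_one p
  have hq0 : (0 : ℝ) < p := by linarith
  have ha1 : 1 < a := by rw [ha]; exact Real.one_lt_rpow hq hα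
  have s0 := fun n => (geo_down hq n).summable
  have hset : ∀ (n : ℤ) (z : ℚ_[p]), ‖z‖ = (p : ℝ) ^ n →
      {y : ℚ_[p] | ‖y‖ ≤ ‖z‖} = closedBall 0 ((p : ℝ) ^ n) := by
    intro n z hz
    ext y
    simp [hz]
  have hcore := fun (n : ℤ) (z : ℚ_[p]) (hz : ‖z‖ = (p : ℝ) ^ n) =>
    I_core p κ K hκ v w hw n z hz (s0 n) (s1 n) (s2 n) (s3 n)
  have hu : ∀ k z, ‖z‖ = (p : ℝ) ^ k → Iop p α v z = U k := by
    intro k z hz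
    unfold Iop
    rw [hset k z hz, hU]
    simp_rw [hI]
    rw [(hcore k z hz).2]
  have hker : ∀ k : ℤ, ((p : ℝ) ^ k) ^ (-α - 1) = ((a * p) ^ k)⁻¹ := by
    intro k
    rw [ha, ← Real.rpow_add_one hq0.ne', ← Real.rpow_intCast, ← Real.rpow_intCast, ← Real.rpow_mul hq0.le,
      ← Real.rpow_mul hq0.le, ← Real.rpow_neg hq0.le]
    congr 1; ring
  refine ⟨fun z => ?_, fun x hx => ?_⟩
  · by_cases hz : z = 0
    · subst hz
      have : {y : ℚ_[p] | ‖y‖ ≤ ‖(0 : ℚ_[p])‖} = {0} := by ext y; simp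
      rw [this]
      exact IntegrableOn.of_measure_zero (haar_null p 0)
    · obtain ⟨n, hn⟩ := padic_exists_norm p hz
      rw [hset n z hn]
      simp_rw [hI]
      exact (hcore n z hn).1
  · obtain ⟨n, hn⟩ := padic_exists_norm p hx
    obtain ⟨t1, t2, t3⟩ := hD n
    obtain ⟨i1, i2⟩ := D_core p α a hker (by linarith) (Iop p α v) U hu n x hn (s0 n) t1
      (geo_up ha1 n).summable t2
    refine ⟨i1, ?_⟩
    unfold Dop
    rw [i2, hw n x hn, ← t3]
    congr 2
    · rw [ha]
    · have := hker 1
      rw [zpow_one, zpow_one] at this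
      rw [this]

set_option maxHeartbeats 1000000 in
lemma final_ne (p : ℕ) [Fact p.Prime] (α : ℝ) (hα : 0 < α) (h1α : α ≠ 1)
    (v : ℚ_[p] → ℝ) (hv : Radial p v) (m : ℤ)
    (h1 : (Summable fun j : ℕ =>
        max ((p : ℝ) ^ (m - j : ℤ)) ((p : ℝ) ^ (α * ((m - j : ℤ) : ℝ))) * |v (sph p (m - j))|) ∧
      Summable fun j : ℕ => |v (sph p (m + j))|) :
    (∀ z : ℚ_[p], IntegrableOn (fun y => Iker p α z y * v y) {y : ℚ_[p] | ‖y‖ ≤ ‖z‖}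
      (padicHaar p)) ∧
    ∀ x : ℚ_[p], x ≠ 0 →
      Integrable (Dker p α (Iop p α v) x) (padicHaar p) ∧
      Dop p α (Iop p α v) x = v x := by
  have hq := q_gt_one p
  have hq0 : (0 : ℝ) < p := by linarith
  obtain ⟨a, ha⟩ : ∃ a, a = (p : ℝ) ^ α := ⟨_, rfl⟩
  have ha1 : 1 < a := by rw [ha]; exact Real.one_lt_rpow hq hα
  have ha0 : 0 < a := by linarith
  have haq : a ≠ p := by
    intro h
    rw [ha] at h
    nth_rewrite 2 [← Real.rpow_one (p : ℝ)] at h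
    exact h1α ((Real.strictMono_rpow_of_base_gt_one hq).injective h)
  have hak : ∀ k : ℤ, (p : ℝ) ^ (α * (k : ℝ)) = a ^ k := by
    intro k
    rw [ha, Real.rpow_mul hq0.le, Real.rpow_intCast]
  obtain ⟨w, hwd⟩ : ∃ w : ℤ → ℝ, ∀ k, v (sph p k) = w k := ⟨_, fun _ => rfl⟩
  have hw : ∀ k z, ‖z‖ = (p : ℝ) ^ k → v z = w k := fun k z hz =>
    (hv _ (sph p k) (by rw [hz, norm_sph])).trans (hwd k)
  simp only [hwd] at h1
  simp_rw [hak] at h1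
  have hA : ∀ n : ℤ, Summable fun j : ℕ => (fun k : ℤ => (p : ℝ) ^ k * w k) (n - j) := by
    refine summ_down (w := fun k : ℤ => (p : ℝ) ^ k * w k) (m := m) (Summable.of_norm_bounded h1.1 fun j => ?_)
    rw [norm_mul, Real.norm_of_nonneg (zpow_pos hq0 _).le, Real.norm_eq_abs]
    exact mul_le_mul_of_nonneg_right (le_max_left _ _) (abs_nonneg _)
  have hB : ∀ n : ℤ, Summable fun j : ℕ => (fun k : ℤ => a ^ k * w k) (n - j) := by
    refine summ_down (w := fun k : ℤ => a ^ k * w k) (m := m) (Summable.of_norm_bounded h1.1 fun j => ?_)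
    rw [norm_mul, Real.norm_of_nonneg (zpow_pos ha0 _).le, Real.norm_eq_abs]
    exact mul_le_mul_of_nonneg_right (le_max_right _ _) (abs_nonneg _)
  have hV : ∀ n : ℤ, Summable fun j : ℕ => w (n + j) :=
    summ_up (w := w) (m := m) h1.2.of_abs
  have eK : ∀ k : ℤ, (p : ℝ) ^ k * (a ^ k / (p : ℝ) ^ k) = a ^ k := fun k =>
    mul_div_cancel₀ _ (zpow_pos hq0 k).ne'
  refine final_core p α a hα ha (fun z => ‖z‖ ^ (α - 1)) (fun k => a ^ k / (p : ℝ) ^ k) ?_ ?_ v w hw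
    ?_ (fun n => hA (n - 1)) ?_ (fun n => a ^ n / a * w n + (1 - 1 / a) / (1 - a / p) * (1 - 1 / p) *
      ((a ^ n / (p : ℝ) ^ n) * lowSum (fun k : ℤ => (p : ℝ) ^ k * w k) n -
        lowSum (fun k : ℤ => a ^ k * w k) n)) ?_
      (series_ne hq ha1 haq w hA hB hV _ (fun n => rfl))
  · intro k z hz
    simp only [hz]
    rw [Real.rpow_sub_one (zpow_pos hq0 k).ne', ← Real.rpow_intCast, ← Real.rpow_mul hq0.le,
      mul_comm, hak]
  · intro x y
    simp [Iker, h1α]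
  · intro n
    simp_rw [eK]
    exact (geo_down ha1 n).summable
  · intro n
    simp_rw [eK]
    exact hB (n - 1)
  · intro n
    simp_rw [eK]
    rw [(geo_down ha1 n).tsum_eq, (geo_down hq n).tsum_eq]
    have hc : Icoef p α = (1 - 1 / a) / (1 - a / p) := by
      simp only [Icoef, h1α, if_false]
      rw [Real.rpow_neg hq0.le, Real.rpow_sub_one hq0.ne', ha, one_div]
    rw [hc]
    unfold lowSum
    generalize (∑' j : ℕ, (p : ℝ) ^ (n - 1 - j : ℤ) * w (n - 1 - j)) = SA
    generalize (∑' j : ℕ, a ^ (n - 1 - j : ℤ) * w (n - 1 - j)) = SB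
    have hQ := zpow_pos hq0 n
    generalize (p : ℝ) ^ n = Q at *
    have n1 : a - 1 ≠ 0 := by linarith
    have n2 : (p : ℝ) - 1 ≠ 0 := by linarith
    have n3 : (p : ℝ) - a ≠ 0 := fun h => haq (by linarith)
    have : 1 - a / p = (p - a) / p := by field_simp
    rw [this]
    field_simp
    ring

set_option maxHeartbeats 1000000 in
lemma final_one (p : ℕ) [Fact p.Prime]
    (v : ℚ_[p] → ℝ) (hv : Radial p v) (m : ℤ)
    (h2 : (Summable fun j : ℕ =>
        |((m - j : ℤ) : ℝ)| * (p : ℝ) ^ (m - j : ℤ) * |v (sph p (m - j))|) ∧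
      Summable fun j : ℕ => ((m + j : ℤ) : ℝ) * |v (sph p (m + j))|) :
    (∀ z : ℚ_[p], IntegrableOn (fun y => Iker p 1 z y * v y) {y : ℚ_[p] | ‖y‖ ≤ ‖z‖}
      (padicHaar p)) ∧
    ∀ x : ℚ_[p], x ≠ 0 →
      Integrable (Dker p 1 (Iop p 1 v) x) (padicHaar p) ∧
      Dop p 1 (Iop p 1 v) x = v x := by
  have hq := q_gt_one p
  have hq0 : (0 : ℝ) < p := by linarith
  have hL : 0 < Real.log p := Real.log_pos hq
  obtain ⟨w, hwd⟩ : ∃ w : ℤ → ℝ, ∀ k, v (sph p k) = w k := ⟨_, fun _ => rfl⟩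
  have hw : ∀ k z, ‖z‖ = (p : ℝ) ^ k → v z = w k := fun k z hz =>
    (hv _ (sph p k) (by rw [hz, norm_sph])).trans (hwd k)
  simp only [hwd] at h2
  have hT : ∀ n : ℤ, Summable fun j : ℕ =>
      ((j : ℝ) + 1) * ((p : ℝ) ^ (n - 1 - j : ℤ) * w (n - 1 - j)) := by
    intro n
    have h := summ_down (w := fun k : ℤ => |(k : ℝ)| * (p : ℝ) ^ k * |w k|) (m := m) h2.1 (n - 1)
    refine Summable.of_norm_bounded_eventually_nat (h.mul_left (|(n : ℝ)| + 1)) ?_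
    filter_upwards [eventually_gt_atTop n.natAbs] with j hj
    have hk : (1 : ℝ) ≤ |((n - 1 - j : ℤ) : ℝ)| := by
      rw [← Int.cast_abs]
      have : (1 : ℤ) ≤ |n - 1 - j| := by rw [abs_of_nonpos (by lia)]; lia
      exact_mod_cast this
    have hj1 : (j : ℝ) + 1 ≤ |(n : ℝ)| + |((n - 1 - j : ℤ) : ℝ)| := by
      have e : (j : ℝ) + 1 = n - ((n - 1 - j : ℤ) : ℝ) := by push_cast; ring
      rw [e]
      linarith [le_abs_self (n : ℝ), neg_abs_le ((n - 1 - j : ℤ) : ℝ)]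
    have hj2 : (j : ℝ) + 1 ≤ (|(n : ℝ)| + 1) * |((n - 1 - j : ℤ) : ℝ)| := by
      nlinarith [abs_nonneg (n : ℝ)]
    rw [norm_mul, norm_mul, Real.norm_of_nonneg (zpow_pos hq0 _).le, Real.norm_eq_abs (w _),
      Real.norm_of_nonneg (by positivity : (0 : ℝ) ≤ (j : ℝ) + 1)]
    calc _ ≤ ((|(n : ℝ)| + 1) * |((n - 1 - j : ℤ) : ℝ)|) *
          ((p : ℝ) ^ (n - 1 - j : ℤ) * |w (n - 1 - j)|) := by gcongr
      _ = _ := by ring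
  have hA : ∀ n : ℤ, Summable fun j : ℕ => (fun k : ℤ => (p : ℝ) ^ k * w k) (n - j) := by
    refine summ_down (w := fun k : ℤ => (p : ℝ) ^ k * w k) (m := 0 - 1) (Summable.of_norm_bounded (hT 0).abs fun j => ?_)
    rw [abs_mul, Real.norm_eq_abs, abs_of_nonneg (by positivity : (0 : ℝ) ≤ (j : ℝ) + 1)]
    exact le_mul_of_one_le_left (abs_nonneg _) (by linarith [Nat.cast_nonneg (α := ℝ) j])
  have hV : ∀ n : ℤ, Summable fun j : ℕ => w (n + j) := by
    refine summ_up (w := w) (m := m) (Summable.of_norm_bounded_eventually_nat h2.2 ?_)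
    filter_upwards [eventually_gt_atTop m.natAbs] with j hj
    have : (1 : ℝ) ≤ ((m + j : ℤ) : ℝ) := by
      have : (1 : ℤ) ≤ m + j := by lia
      exact_mod_cast this
    rw [Real.norm_eq_abs]
    exact le_mul_of_one_le_left (abs_nonneg _) this
  set C : ℤ → ℝ := fun n => ∑' j : ℕ, ((j : ℝ) + 1) * ((p : ℝ) ^ (n - 1 - j : ℤ) * w (n - 1 - j))
    with hC
  have hC1 : ∀ n, C (n + 1) = C n + (lowSum (fun k : ℤ => (p : ℝ) ^ k * w k) n + (p : ℝ) ^ n * w n) := by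
    intro n
    have e0 := (hT (n + 1)).tsum_eq_zero_add
    have e1 : ∀ j : ℕ, (((j + 1 : ℕ) : ℝ) + 1) * ((p : ℝ) ^ (n + 1 - 1 - (j + 1 : ℕ) : ℤ) *
        w (n + 1 - 1 - (j + 1 : ℕ))) =
        ((j : ℝ) + 1) * ((p : ℝ) ^ (n - 1 - j : ℤ) * w (n - 1 - j)) +
          (p : ℝ) ^ (n - 1 - j : ℤ) * w (n - 1 - j) := by
      intro j
      have : (n + 1 - 1 - (j + 1 : ℕ) : ℤ) = n - 1 - j := by push_cast; ring
      rw [this]; push_cast; ring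
    simp_rw [e1] at e0
    rw [(hT n).tsum_add (hA (n - 1))] at e0
    simp only [hC, lowSum]
    rw [e0]
    simp
    ring
  have hCb : ∀ n : ℤ, ∃ M, ∀ j : ℕ, |C (n - 1 - j)| ≤ M := by
    intro n
    refine ⟨∑' j : ℕ, |((j : ℝ) + 1) * ((p : ℝ) ^ (n - 1 - j : ℤ) * w (n - 1 - j))|, fun i => ?_⟩
    have h1 := (hT (n - 1 - i)).abs
    have h2 := (hT n).abs
    have h3 : |C (n - 1 - i)| ≤
        ∑' j : ℕ, |((j : ℝ) + 1) * ((p : ℝ) ^ (n - 1 - i - 1 - j : ℤ) * w (n - 1 - i - 1 - j))| := by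
      have := norm_tsum_le_tsum_norm (f := fun j : ℕ =>
        ((j : ℝ) + 1) * ((p : ℝ) ^ (n - 1 - i - 1 - j : ℤ) * w (n - 1 - i - 1 - j))) h1
      exact this
    refine h3.trans ?_
    rw [← h2.sum_add_tsum_nat_add (i + 1)]
    refine le_trans ?_ (le_add_of_nonneg_left (Finset.sum_nonneg fun _ _ => abs_nonneg _))
    refine h1.tsum_le_tsum (fun j => ?_) ((summable_nat_add_iff (i + 1)).2 h2)
    have : (n - 1 - i - 1 - j : ℤ) = n - 1 - ((j + (i + 1) : ℕ) : ℤ) := by push_cast; ring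
    rw [this, abs_mul, abs_mul ((((j + (i + 1) : ℕ)) : ℝ) + 1)]
    refine mul_le_mul_of_nonneg_right ?_ (abs_nonneg _)
    rw [abs_of_nonneg (by positivity), abs_of_nonneg (by positivity)]
    push_cast
    linarith [Nat.cast_nonneg (α := ℝ) i]
  have eK : ∀ (n : ℤ) (j : ℕ), (p : ℝ) ^ (n - 1 - j : ℤ) * (((n - 1 - j : ℤ) : ℝ) * Real.log p) =
      Real.log p * (n * (p : ℝ) ^ (n - 1 - j : ℤ) - ((j : ℝ) + 1) * (p : ℝ) ^ (n - 1 - j : ℤ)) := by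
    intro n j; push_cast; ring
  have eKw : ∀ (n : ℤ) (j : ℕ), (p : ℝ) ^ (n - 1 - j : ℤ) * (((n - 1 - j : ℤ) : ℝ) * Real.log p)
        * w (n - 1 - j) =
      Real.log p * (n * ((p : ℝ) ^ (n - 1 - j : ℤ) * w (n - 1 - j)) -
        ((j : ℝ) + 1) * ((p : ℝ) ^ (n - 1 - j : ℤ) * w (n - 1 - j))) := by
    intro n j; push_cast; ring
  refine final_core p 1 p one_pos (Real.rpow_one _).symm (fun z => Real.log ‖z‖)
    (fun k => (k : ℝ) * Real.log p) ?_ ?_ v w hw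
    ?_ (fun n => hA (n - 1)) ?_
    (fun n => (p : ℝ) ^ n / p * w n - ((p : ℝ) - 1) ^ 2 / (p : ℝ) ^ 2 * C n) ?_
    (series_one hq w C hA hC1 hCb hV _ (fun n => rfl))
  · intro k z hz
    simp only [hz]
    rw [Real.log_zpow]
  · intro x y
    simp [Iker]
  · intro n
    simp_rw [eK]
    exact (((geo_down hq n).summable.mul_left _).sub (geo_down' hq n).summable).mul_left _
  · intro n
    simp_rw [eKw]
    exact ((Summable.mul_left _ (hA (n - 1))).sub (hT n)).mul_left _
  · intro n
    simp_rw [eKw, eK]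
    rw [tsum_mul_left, tsum_mul_left, (Summable.mul_left _ (hA (n - 1))).tsum_sub (hT n),
      ((geo_down hq n).summable.mul_left _).tsum_sub (geo_down' hq n).summable, tsum_mul_left,
      tsum_mul_left, (geo_down hq n).tsum_eq, (geo_down' hq n).tsum_eq]
    simp only [Icoef, if_true, hC]
    generalize (∑' j : ℕ, (p : ℝ) ^ (n - 1 - j : ℤ) * w (n - 1 - j)) = SA
    generalize (∑' j : ℕ, ((j : ℝ) + 1) * ((p : ℝ) ^ (n - 1 - j : ℤ) * w (n - 1 - j))) = SC
    have n2 : (p : ℝ) - 1 ≠ 0 := by linarith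
    field_simp
    ring

end finalPart

/-- `I^α` is a right inverse of `D^α` on suitable radial functions. -/
theorem D_right_inverse_I (p : ℕ) [Fact p.Prime] (α : ℝ) (hα : 0 < α)
    (v : ℚ_[p] → ℝ) (hv : Radial p v) (m : ℤ)
    (h1 : α ≠ 1 →
      (Summable fun j : ℕ =>
        max ((p : ℝ) ^ (m - j : ℤ)) ((p : ℝ) ^ (α * ((m - j : ℤ) : ℝ))) * |v (sph p (m - j))|) ∧
      Summable fun j : ℕ => |v (sph p (m + j))|)
    (h2 : α = 1 →
      (Summable fun j : ℕ =>
        |((m - j : ℤ) : ℝ)| * (p : ℝ) ^ (m - j : ℤ) * |v (sph p (m - j))|) ∧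
      Summable fun j : ℕ => ((m + j : ℤ) : ℝ) * |v (sph p (m + j))|) :
    (∀ z : ℚ_[p], IntegrableOn (fun y => Iker p α z y * v y) {y : ℚ_[p] | ‖y‖ ≤ ‖z‖}
      (padicHaar p)) ∧
    ∀ x : ℚ_[p], x ≠ 0 →
      Integrable (Dker p α (Iop p α v) x) (padicHaar p) ∧
      Dop p α (Iop p α v) x = v x := by
  by_cases h : α = 1
  · subst h; exact final_one p v hv m (h2 rfl)
  · exact final_ne p α hα h v hv m (h1 h)
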